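/- For every 0 < p < p' < 1 there exist measurable functions F : {0,1}^ℤ → {0,1}^ℤ and G : {0,1}^ℤ → {0,1}^ℕ such that F is a discrete thickening from density p to density p' on {0,1}^ℤ and, when X ~ Bernoulli(p)^ℤ, G(X) ~ Bernoulli(1/2)^ℕ with G(X) independent of F(X). That is, in addition to the thickened process F(X), one may extract infinitely many i.i.d. fair bits which are functions of X and independent of F(X). -/

import Mathlib

open MeasureTheory ProbabilityTheory

/-- The Bernoulli measure on `Bool` assigning mass `r` to `true`. -/
noncomputable def bernoulliMeasure (r : ℝ) : Measure Bool :=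
  ENNReal.ofReal r • Measure.dirac true + ENNReal.ofReal (1 - r) • Measure.dirac false

/-- `μ` is the product of Bernoulli(`r`) measures over the index set `I`:
it is a probability measure whose finite-dimensional marginals are i.i.d. Bernoulli(`r`). -/
def IsBernoulliProduct {I : Type*} (r : ℝ) (μ : Measure (I → Bool)) : Prop :=
  IsProbabilityMeasure μ ∧
    ∀ (s : Finset I) (b : I → Bool),
      μ {x | ∀ i ∈ s, x i = b i} =
        ∏ i ∈ s, (if b i then ENNReal.ofReal r else ENNReal.ofReal (1 - r))

open Measure Filter Topology

lemma isProbabilityMeasure_bernoulliMeasure {r : ℝ} (h0 : 0 ≤ r) (h1 : r ≤ 1) :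
    IsProbabilityMeasure (bernoulliMeasure r) := by
  constructor
  simp only [_root_.bernoulliMeasure, coe_add, coe_smul, Pi.add_apply, Pi.smul_apply, measure_univ,
    smul_eq_mul, mul_one]
  rw [← ENNReal.ofReal_add h0 (by linarith)]
  simp

lemma bernoulliMeasure_singleton (r : ℝ) (b : Bool) :
    bernoulliMeasure r {b} = if b then ENNReal.ofReal r else ENNReal.ofReal (1 - r) := by
  cases b <;> simp [_root_.bernoulliMeasure]

lemma isBernoulliProduct_iff {I : Type*} {r : ℝ} [IsProbabilityMeasure (bernoulliMeasure r)]
    {μ : Measure (I → Bool)} :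
    IsBernoulliProduct r μ ↔ μ = infinitePi (fun _ : I ↦ bernoulliMeasure r) := by
  constructor
  · rintro ⟨hμ, h⟩
    refine IsProjectiveLimit.unique (fun s ↦ ?_)
      (isProjectiveLimit_infinitePi (fun _ : I ↦ bernoulliMeasure r))
    refine ext_of_singleton fun b ↦ ?_
    rw [map_apply (by fun_prop) (measurableSet_singleton b), Measure.pi_singleton]
    classical
    have := h s (fun i ↦ if hi : i ∈ s then b ⟨i, hi⟩ else false)
    convert this using 1
    · congr 1
      ext x
      simp only [Set.mem_preimage, Set.mem_singleton_iff, funext_iff, Finset.restrict,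
        Subtype.forall, Set.mem_ofPred_eq]
      exact forall₂_congr fun i hi ↦ by simp [hi]
    · rw [← Finset.prod_attach s]
      simp [bernoulliMeasure_singleton]
  · rintro rfl
    refine ⟨inferInstance, fun s b ↦ ?_⟩
    have : {x : I → Bool | ∀ i ∈ s, x i = b i} = (s : Set I).pi fun i ↦ {b i} := by
      ext x; simp [Set.mem_pi]
    rw [this, infinitePi_pi _ fun _ _ ↦ measurableSet_singleton _]
    simp [bernoulliMeasure_singleton]

instance : IsProbabilityMeasure (bernoulliMeasure (1 / 2)) :=
  isProbabilityMeasure_bernoulliMeasure (by norm_num) (by norm_num)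

/-- The law of a sequence of i.i.d. fair bits. -/
noncomputable def fairBits (I : Type*) : Measure (I → Bool) :=
  infinitePi fun _ ↦ bernoulliMeasure (1 / 2)

instance (I : Type*) : IsProbabilityMeasure (fairBits I) := by
  unfold fairBits; infer_instance

lemma nullSingletonClass_fairBits : NullSingletonClass (fairBits ℕ) := by
  refine ⟨fun x ↦ ?_⟩
  have key (n : ℕ) : fairBits ℕ {x} ≤ (2⁻¹ : ENNReal) ^ n := by
    calc fairBits ℕ {x} ≤ fairBits ℕ ((Finset.range n : Set ℕ).pi fun i ↦ {x i}) := by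
          refine measure_mono ?_
          rintro _ rfl
          simp [Set.mem_pi]
      _ = (2⁻¹ : ENNReal) ^ n := by
          have h2 : ENNReal.ofReal (1 / 2) = 2⁻¹ := by
            rw [one_div, ENNReal.ofReal_inv_of_pos (by norm_num)]; simp
          have h3 : ENNReal.ofReal (1 - 1 / 2) = 2⁻¹ := by rw [← h2]; norm_num
          rw [fairBits, infinitePi_pi _ fun _ _ ↦ measurableSet_singleton _]
          simp only [bernoulliMeasure_singleton, h2, h3, ite_self, Finset.prod_const,
            Finset.card_range]
  refine le_antisymm (ge_of_tendsto' (ENNReal.tendsto_pow_atTop_nhds_zero_of_lt_one ?_) key)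
    zero_le
  simp

lemma continuous_cdf {μ : Measure ℝ} [IsProbabilityMeasure μ] [NullSingletonClass μ] :
    Continuous (cdf μ) := by
  refine continuous_iff_continuousAt.2 fun x ↦ ?_
  rw [(monotone_cdf μ).continuousAt_iff_leftLim_eq_rightLim, StieltjesFunction.rightLim_eq]
  have h := (cdf μ).measure_singleton x
  rw [measure_cdf, measure_singleton, eq_comm, ENNReal.ofReal_eq_zero] at h
  exact le_antisymm ((monotone_cdf μ).leftLim_le le_rfl) (by linarith)

/-- The probability integral transform. -/
lemma map_cdf_eq_volume {μ : Measure ℝ} [IsProbabilityMeasure μ] [NullSingletonClass μ] :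
    μ.map (fun x ↦ (⟨cdf μ x, cdf_nonneg μ x, cdf_le_one μ x⟩ : unitInterval)) = volume := by
  have hmeas : Measurable (fun x ↦ (⟨cdf μ x, cdf_nonneg μ x, cdf_le_one μ x⟩ : unitInterval)) :=
    (monotone_cdf μ).measurable.subtype_mk
  have := isProbabilityMeasure_map (μ := μ) hmeas.aemeasurable
  have hvol (t : unitInterval) : volume (Set.Iic t) = ENNReal.ofReal t := by
    simp [unitInterval.volume_Iic]
  have hex (t : ℝ) (h0 : 0 < t) (h1 : t < 1) : ∃ x, cdf μ x = t :=
    mem_range_of_exists_le_of_exists_ge continuous_cdf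
      (((tendsto_cdf_atBot μ).eventually_le_const h0).exists)
      (((tendsto_cdf_atTop μ).eventually_const_le h1).exists)
  refine ext_of_Iic _ _ fun t ↦ ?_
  rw [hvol, map_apply hmeas measurableSet_Iic]
  have hset : (fun x ↦ (⟨cdf μ x, cdf_nonneg μ x, cdf_le_one μ x⟩ : unitInterval)) ⁻¹' Set.Iic t =
      {x | cdf μ x ≤ t} := rfl
  rw [hset, ← ofReal_measureReal]
  congr 1
  have hIic (x : ℝ) : μ.real (Set.Iic x) = cdf μ x := (cdf_eq_real μ x).symm
  refine le_antisymm ?_ ?_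
  · by_contra! hlt
    have h1 : μ.real {x | cdf μ x ≤ t} ≤ 1 := measureReal_le_one
    obtain ⟨y, hy⟩ := hex ((t + μ.real {x | cdf μ x ≤ t}) / 2) (by linarith [t.2.1]) (by linarith)
    have : μ.real {x | cdf μ x ≤ t} ≤ μ.real (Set.Iic y) := by
      refine measureReal_mono fun x hx ↦ ?_
      by_contra hxy
      have := monotone_cdf μ (not_le.1 hxy).le
      have hx' : cdf μ x ≤ t := hx
      linarith
    rw [hIic, hy] at this
    linarith
  · by_contra! hlt
    have h0 : 0 ≤ μ.real {x | cdf μ x ≤ t} := measureReal_nonneg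
    obtain ⟨y, hy⟩ := hex ((t + μ.real {x | cdf μ x ≤ t}) / 2) (by linarith) (by linarith [t.2.2])
    have : μ.real (Set.Iic y) ≤ μ.real {x | cdf μ x ≤ t} := by
      refine measureReal_mono fun x hx ↦ ?_
      have := monotone_cdf μ (show x ≤ y from hx)
      show cdf μ x ≤ t
      linarith
    rw [hIic, hy] at this
    linarith

/-- Every Markov kernel can be sampled from a sequence of i.i.d. fair bits. -/
lemma exists_measurable_map_fairBits_eq {X Y : Type*} [MeasurableSpace X] [MeasurableSpace Y]
    [StandardBorelSpace Y] [Nonempty Y] (κ : Kernel X Y) [IsMarkovKernel κ] :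
    ∃ f : X → (ℕ → Bool) → Y, Measurable (Function.uncurry f) ∧
      ∀ a, (fairBits ℕ).map (f a) = κ a := by
  have hg := measurableEmbedding_embeddingReal (ℕ → Bool)
  have := nullSingletonClass_fairBits
  let ρ := (fairBits ℕ).map (embeddingReal (ℕ → Bool))
  have : IsProbabilityMeasure ρ := isProbabilityMeasure_map hg.measurable.aemeasurable
  have : NullSingletonClass ρ := by
    refine ⟨fun x ↦ ?_⟩
    rw [hg.map_apply]
    exact (Set.subsingleton_singleton.preimage hg.injective).measure_zero _
  obtain ⟨f, hf, hfκ⟩ := κ.exists_measurable_map_eq_unitInterval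
  have hc : Measurable (fun x ↦ (⟨cdf ρ x, cdf_nonneg ρ x, cdf_le_one ρ x⟩ : unitInterval)) :=
    (monotone_cdf ρ).measurable.subtype_mk
  refine ⟨fun a u ↦ f a ⟨cdf ρ (embeddingReal _ u), cdf_nonneg ρ _, cdf_le_one ρ _⟩,
    ?_, fun a ↦ ?_⟩
  · exact hf.comp (measurable_fst.prodMk (hc.comp (hg.measurable.comp measurable_snd)))
  · have hfa : Measurable (f a) := hf.comp measurable_prodMk_left
    rw [← hfκ, ← map_cdf_eq_volume (μ := ρ), map_map hc hg.measurable]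
    exact (map_map hfa (hc.comp hg.measurable)).symm
lemma exists_two_mul_pow_le {p p' : ℝ} (hp : 0 < p) (hpp' : p < p') (hp' : p' < 1) :
    ∃ k : ℕ, 2 * p ^ (k + 1) * (1 - p') ≤ p' ^ k * (p' - p) ^ 2 := by
  have hp'0 : 0 < p' := hp.trans hpp'
  have hd : 0 < (p' - p) ^ 2 / 2 := by have := sub_pos.2 hpp'; positivity
  obtain ⟨k, hk⟩ := exists_pow_lt_of_lt_one hd ((div_lt_one hp'0).2 hpp')
  refine ⟨k, ?_⟩
  rw [div_pow, div_lt_iff₀ (by positivity)] at hk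
  have h1 : p * (1 - p') ≤ 1 := by nlinarith
  have : p ^ k * (p * (1 - p')) ≤ p ^ k * 1 := by gcongr
  calc 2 * p ^ (k + 1) * (1 - p') = 2 * (p ^ k * (p * (1 - p'))) := by ring
    _ ≤ _ := by linarith

/-- The weight of a bit under the Bernoulli measure. -/
def bitWeight (p : ℝ) (b : Bool) : ℝ := if b then p else 1 - p

/-- The monotone kernel on a single bit, sending density `p` to density `p'`. -/
noncomputable def bitKernel (p p' : ℝ) (x y : Bool) : ℝ :=
  if x then (if y then 1 else 0) else (if y then (p' - p) / (1 - p) else (1 - p') / (1 - p))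

/-- The all-ones word with a zero at position `j`. -/
def oneZero {n : ℕ} (j : Fin n) : Fin n → Bool := fun i ↦ decide (i ≠ j)

lemma prod_bitKernel_oneZero {p p' : ℝ} {n : ℕ} (j : Fin n) (y : Fin n → Bool) :
    ∏ i, bitKernel p p' (oneZero j i) (y i) =
      (if y = oneZero j then (1 - p') / (1 - p) else 0) +
        (if y = fun _ ↦ true then (p' - p) / (1 - p) else 0) := by
  by_cases h : ∃ i, i ≠ j ∧ y i = false
  · obtain ⟨i, hij, hi⟩ := h
    rw [Finset.prod_eq_zero (Finset.mem_univ i) (by simp [bitKernel, oneZero, hij, hi]),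
      if_neg, if_neg, add_zero]
    · rintro rfl; simp at hi
    · rintro rfl; simp [oneZero, hij] at hi
  · push Not at h
    simp only [ne_eq, Bool.not_eq_false] at h
    rw [Finset.prod_eq_single j (fun i _ hi ↦ by simp [bitKernel, oneZero, hi, h i hi])
      (by simp)]
    have e1 : y = oneZero j ↔ y j = false := by
      refine ⟨by rintro rfl; simp [oneZero], fun hj ↦ funext fun i ↦ ?_⟩
      by_cases hi : i = j
      · subst hi; simp [oneZero, hj]
      · simp [oneZero, hi, h i hi]
    have e2 : (y = fun _ ↦ true) ↔ y j = true := by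
      refine ⟨by rintro rfl; rfl, fun hj ↦ funext fun i ↦ ?_⟩
      by_cases hi : i = j
      · subst hi; exact hj
      · exact h i hi
    simp only [e1, e2]
    cases y j <;> simp [bitKernel, oneZero]

lemma sum_prod_eq_prod_sum {n : ℕ} (f : Fin n → Bool → ℝ) :
    ∑ x : Fin n → Bool, ∏ i, f i (x i) = ∏ i, (f i true + f i false) := by
  simp_rw [← Fintype.sum_bool, Finset.prod_univ_sum, Fintype.piFinset_univ]

/-- There are a block length and a monotone kernel between blocks which does not distinguish two
words of equal weight. -/
lemma exists_blockKernel {p p' : ℝ} (hp : 0 < p) (hpp' : p < p') (hp' : p' < 1) :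
    ∃ (n : ℕ) (a b : Fin n → Bool) (κ : (Fin n → Bool) → (Fin n → Bool) → ℝ),
      a ≠ b ∧ ∏ i, bitWeight p (a i) = ∏ i, bitWeight p (b i) ∧
      (∀ x y, 0 ≤ κ x y) ∧ (∀ x, ∑ y, κ x y = 1) ∧ (∀ x y, κ x y ≠ 0 → x ≤ y) ∧
      (∀ y, ∑ x, (∏ i, bitWeight p (x i)) * κ x y = ∏ i, bitWeight p' (y i)) ∧ κ a = κ b := by
  obtain ⟨k, hk⟩ := exists_two_mul_pow_le hp hpp' hp'
  have hp1 : 0 < 1 - p := by linarith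
  have hp'1 : 0 < 1 - p' := by linarith
  have hd : 0 < p' - p := by linarith
  have hp'0 : 0 < p' := by linarith
  let M (x : Fin (k + 2) → Bool) : ℝ := ∏ i, bitWeight p (x i)
  let st (x y : Fin (k + 2) → Bool) : ℝ := ∏ i, bitKernel p p' (x i) (y i)
  let one : Fin (k + 2) → Bool := fun _ ↦ true
  let a : Fin (k + 2) → Bool := oneZero 0
  let b : Fin (k + 2) → Bool := oneZero 1
  have hab : a ≠ b := fun h ↦ by simpa [a, b, oneZero] using congrFun h 0
  have ha1 : a ≠ one := fun h ↦ by simpa [a, one, oneZero] using congrFun h 0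
  have hb1 : b ≠ one := fun h ↦ by simpa [b, one, oneZero] using congrFun h 1
  have hbit (x y : Bool) : 0 ≤ bitKernel p p' x y := by
    cases x <;> cases y <;> simp [bitKernel] <;> positivity
  have hst0 (x y) : 0 ≤ st x y := Finset.prod_nonneg fun _ _ ↦ hbit _ _
  have hst1 (x) : ∑ y, st x y = 1 := by
    simp only [st]
    rw [sum_prod_eq_prod_sum fun i c ↦ bitKernel p p' (x i) c]
    refine Finset.prod_eq_one fun i _ ↦ ?_
    cases x i <;> simp [bitKernel]
    field_simp; ring
  have hstM (y) : ∑ x, M x * st x y = ∏ i, bitWeight p' (y i) := by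
    simp only [st, M, ← Finset.prod_mul_distrib]
    rw [sum_prod_eq_prod_sum fun i c ↦ bitWeight p c * bitKernel p p' c (y i)]
    refine Finset.prod_congr rfl fun i _ ↦ ?_
    cases y i <;> simp [bitKernel, bitWeight] <;> field_simp
    ring
  have hstle (x y) (h : st x y ≠ 0) : x ≤ y := by
    intro i
    have := Finset.prod_ne_zero_iff.1 h i (Finset.mem_univ i)
    revert this
    cases x i <;> cases y i <;> simp [bitKernel]
  have hM (j : Fin (k + 2)) : M (oneZero j) = p ^ (k + 1) * (1 - p) := by
    simp only [M]
    rw [← Finset.mul_prod_erase _ _ (Finset.mem_univ j), mul_comm,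
      Finset.prod_congr rfl (g := fun _ ↦ p)]
    · simp [bitWeight, oneZero, Finset.card_erase_of_mem]
    · intro i hi
      simp [bitWeight, oneZero, Finset.ne_of_mem_erase hi]
  have hsum : ∑ x, (if x 0 = false ∧ x 1 = false then M x * st x one else 0) =
      p' ^ k * (p' - p) ^ 2 := by
    have := sum_prod_eq_prod_sum fun (i : Fin (k + 2)) c ↦
      if (i = 0 ∨ i = 1) ∧ c = true then 0 else bitWeight p c * bitKernel p p' c true
    calc _ = _ := Finset.sum_congr rfl fun x _ ↦ ?_
      _ = _ := this
      _ = _ := ?_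
    · split_ifs with h
      · simp only [M, st, one, ← Finset.prod_mul_distrib]
        refine Finset.prod_congr rfl fun i _ ↦ ?_
        rw [if_neg]
        rintro ⟨rfl | rfl, h'⟩ <;> simp_all
      · rw [not_and_or] at h
        symm
        rcases h with h | h
        · exact Finset.prod_eq_zero (Finset.mem_univ 0)
            (by simp only [Bool.not_eq_false] at h; simp [h])
        · exact Finset.prod_eq_zero (Finset.mem_univ 1)
            (by simp only [Bool.not_eq_false] at h; simp [h])
    · have h2 (i : Fin k) : i.succ.succ ≠ 1 := by simp [Fin.ext_iff]
      simp [Fin.prod_univ_succ, h2, bitWeight, bitKernel]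
      field_simp
      ring
  set S := p' ^ k * (p' - p) ^ 2 with hS
  have hS0 : 0 < S := by positivity
  let ρ : ℝ := p ^ (k + 1) * (1 - p') / S
  have hρ0 : 0 ≤ ρ := by positivity
  have hρ : 2 * ρ ≤ 1 := by
    simp only [ρ]
    rw [← mul_div_assoc, div_le_one hS0]; linarith
  let δ (z y : Fin (k + 2) → Bool) : ℝ := if y = z then 1 else 0
  let κ (x y : Fin (k + 2) → Bool) : ℝ :=
    if x = a ∨ x = b then δ one y else
      st x y + if x 0 = false ∧ x 1 = false then
        ρ * st x one * (δ a y + δ b y - 2 * δ one y) else 0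
  have hδ (z) : ∑ y, δ z y = 1 := by simp [δ]
  have hsta (y) : st a y = (1 - p') / (1 - p) * δ a y + (p' - p) / (1 - p) * δ one y := by
    simp [st, a, prod_bitKernel_oneZero, δ, one]
  have hstb (y) : st b y = (1 - p') / (1 - p) * δ b y + (p' - p) / (1 - p) * δ one y := by
    simp [st, b, prod_bitKernel_oneZero, δ, one]
  refine ⟨k + 2, a, b, κ, hab, (hM 0).trans (hM 1).symm, fun x y ↦ ?_, fun x ↦ ?_,
    fun x y h ↦ ?_, fun y ↦ ?_, ?_⟩
  · simp only [κ]
    split_ifs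
    · simp only [δ]; split_ifs <;> norm_num
    · have h1 := hst0 x y
      have h2 := hst0 x one
      by_cases hy : y = one
      · subst hy
        simp only [δ, if_neg ha1.symm, if_neg hb1.symm, if_true]
        nlinarith
      · simp only [δ, if_neg hy]
        have : 0 ≤ ρ * st x one := by positivity
        split_ifs <;> linarith
    · simpa using hst0 x y
  · simp only [κ]
    split_ifs
    · exact hδ one
    · rw [Finset.sum_add_distrib, hst1, ← Finset.mul_sum, Finset.sum_sub_distrib,
        Finset.sum_add_distrib, ← Finset.mul_sum, hδ, hδ, hδ]
      ring
    · simpa using hst1 x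
  · have hle1 : x ≤ one := fun i ↦ Bool.le_true _
    by_contra hxy
    have hst : st x y = 0 := by_contra fun h' ↦ hxy (hstle x y h')
    have hy1 : δ one y = 0 := if_neg fun h' : y = one ↦ hxy (h' ▸ hle1)
    apply h
    simp only [κ, hst, hy1]
    split_ifs with h1 h2
    · rfl
    · have hya : δ a y = 0 := if_neg fun h' : y = a ↦ hxy (h' ▸ fun i ↦ by
        by_cases hi : i = 0
        · subst hi; simp [h2]
        · simp [a, oneZero, hi, Bool.le_true])
      have hyb : δ b y = 0 := if_neg fun h' : y = b ↦ hxy (h' ▸ fun i ↦ by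
        by_cases hi : i = 1
        · subst hi; simp [h2]
        · simp [b, oneZero, hi, Bool.le_true])
      rw [hya, hyb]; ring
    · ring
  · have hpt (x) : M x * κ x y = M x * st x y +
        (if x = a then M a * (δ one y - st a y) else 0) +
        (if x = b then M b * (δ one y - st b y) else 0) +
        ρ * (δ a y + δ b y - 2 * δ one y) *
          (if x 0 = false ∧ x 1 = false then M x * st x one else 0) := by
      simp only [κ]
      by_cases hxa : x = a
      · subst hxa
        have : ¬ (a 0 = false ∧ a 1 = false) := by simp [a, oneZero]
        simp only [true_or, if_true, if_neg hab, if_neg this]; ring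
      by_cases hxb : x = b
      · subst hxb
        have : ¬ (b 0 = false ∧ b 1 = false) := by simp [b, oneZero]
        simp only [or_true, if_true, if_neg hab.symm, if_neg this]; ring
      simp only [hxa, hxb, or_self, if_false]
      split_ifs <;> ring
    calc ∑ x, M x * κ x y = _ := Finset.sum_congr rfl fun x _ ↦ hpt x
      _ = (∏ i, bitWeight p' (y i)) + M a * (δ one y - st a y) + M b * (δ one y - st b y) +
          ρ * (δ a y + δ b y - 2 * δ one y) * S := by
        rw [Finset.sum_add_distrib, Finset.sum_add_distrib, Finset.sum_add_distrib, hstM,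
          ← Finset.mul_sum, hsum]
        simp
      _ = _ := by
        have hρS : ρ * S = p ^ (k + 1) * (1 - p') := div_mul_cancel₀ _ hS0.ne'
        rw [hsta, hstb, show M a = _ from hM 0, show M b = _ from hM 1,
          mul_right_comm ρ, hρS]
        field_simp
        ring
  · funext y
    simp [κ]
/-- The thickening of a block of bits driven by fair bits, blind to the difference between two
equiprobable words. -/
lemma exists_blockThickening {p p' : ℝ} (hp : 0 < p) (hpp' : p < p') (hp' : p' < 1) :
    ∃ (n : ℕ) (a b : Fin n → Bool) (φ : (Fin n → Bool) → (ℕ → Bool) → (Fin n → Bool)),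
      a ≠ b ∧
      infinitePi (fun _ : Fin n ↦ _root_.bernoulliMeasure p) {a} =
        infinitePi (fun _ : Fin n ↦ _root_.bernoulliMeasure p) {b} ∧
      infinitePi (fun _ : Fin n ↦ _root_.bernoulliMeasure p) {a} ≠ 0 ∧
      Measurable (Function.uncurry φ) ∧
      ((infinitePi (fun _ : Fin n ↦ _root_.bernoulliMeasure p)).prod (fairBits ℕ)).map
        (Function.uncurry φ) = infinitePi (fun _ : Fin n ↦ _root_.bernoulliMeasure p') ∧
      (∀ x u, x ≤ φ x u) ∧ φ a = φ b := by
  classical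
  obtain ⟨n, a, b, κ, hab, hwab, hκ0, hκ1, hκle, hκp, hκab⟩ := exists_blockKernel hp hpp' hp'
  have hber (r : ℝ) (h0 : 0 < r) (h1 : r < 1) (x : Fin n → Bool) :
      infinitePi (fun _ : Fin n ↦ _root_.bernoulliMeasure r) {x} =
        ENNReal.ofReal (∏ i, bitWeight r (x i)) := by
    have := isProbabilityMeasure_bernoulliMeasure h0.le h1.le
    rw [infinitePi_singleton_of_fintype, ENNReal.ofReal_prod_of_nonneg]
    · refine Finset.prod_congr rfl fun i _ ↦ ?_
      rw [bernoulliMeasure_singleton, bitWeight]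
      split_ifs <;> rfl
    · intro i _
      rw [bitWeight]
      split_ifs <;> linarith
  have hp1 : p < 1 := hpp'.trans hp'
  have := isProbabilityMeasure_bernoulliMeasure hp.le hp1.le
  let q (x : Fin n → Bool) : PMF (Fin n → Bool) := PMF.ofFintype (fun y ↦ ENNReal.ofReal (κ x y))
    (by rw [← ENNReal.ofReal_sum_of_nonneg fun _ _ ↦ hκ0 _ _, hκ1, ENNReal.ofReal_one])
  let K : Kernel (Fin n → Bool) (Fin n → Bool) := Kernel.ofFunOfCountable fun x ↦ (q x).toMeasure
  have : IsMarkovKernel K := ⟨fun x ↦ inferInstanceAs (IsProbabilityMeasure (q x).toMeasure)⟩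
  have hK (x y) : K x {y} = ENNReal.ofReal (κ x y) :=
    (q x).toMeasure_apply_singleton y (measurableSet_singleton y)
  obtain ⟨f, hf, hfK⟩ := exists_measurable_map_fairBits_eq K
  have hfm (x) : Measurable (f x) := hf.comp measurable_prodMk_left
  let r (x : Fin n → Bool) : Fin n → Bool := if x = b then a else x
  have hκr (x) : κ (r x) = κ x := by
    by_cases h : x = b
    · simp [r, h, hκab]
    · simp [r, h]
  let s (x : Fin n → Bool) : Fin n → Bool := if x = a ∨ x = b then a ⊔ b else x
  have hsle (x) : x ≤ s x := by
    by_cases h : x = a ∨ x = b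
    · simp only [s, if_pos h]
      rcases h with rfl | rfl
      exacts [le_sup_left, le_sup_right]
    · simp [s, h]
  have hκs (x y) (h : κ x y ≠ 0) : s x ≤ y := by
    by_cases hx : x = a ∨ x = b
    · simp only [s, if_pos hx]
      rcases hx with rfl | rfl
      · exact sup_le (hκle _ _ h) (hκle _ _ (hκab ▸ h))
      · exact sup_le (hκle _ _ (hκab ▸ h)) (hκle _ _ h)
    · simpa [s, hx] using hκle _ _ h
  let φ (x : Fin n → Bool) (u : ℕ → Bool) : Fin n → Bool := s x ⊔ f (r x) u
  have hφ : Measurable (Function.uncurry φ) :=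
    measurable_from_prod_countable_right fun x ↦
      (measurable_of_countable (fun y ↦ s x ⊔ y)).comp (hfm (r x))
  have hae (x) : ∀ᵐ u ∂fairBits ℕ, φ x u = f (r x) u := by
    have : ∀ᵐ y ∂K (r x), s x ≤ y := by
      refine ae_iff_of_countable.2 fun y hy ↦ hκs x y fun h ↦ hy ?_
      rw [hK, hκr, h, ENNReal.ofReal_zero]
    rw [← hfK] at this
    filter_upwards [ae_of_ae_map (hfm _).aemeasurable this] with u hu
    exact sup_eq_right.2 hu
  refine ⟨n, a, b, φ, hab, ?_, ?_, hφ, ?_, fun x u ↦ (hsle x).trans le_sup_left, ?_⟩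
  · rw [hber p hp hp1, hber p hp hp1, hwab]
  · rw [hber p hp hp1, Ne, ENNReal.ofReal_eq_zero, not_le]
    refine Finset.prod_pos fun i _ ↦ ?_
    rw [bitWeight]
    split_ifs <;> linarith
  · refine ext_of_singleton fun y ↦ ?_
    rw [map_apply hφ (measurableSet_singleton y), prod_apply (hφ (measurableSet_singleton y)),
      lintegral_fintype, hber p' (hp.trans hpp') hp', ← hκp, ENNReal.ofReal_sum_of_nonneg]
    · refine Finset.sum_congr rfl fun x _ ↦ ?_
      have hset : fairBits ℕ (Prod.mk x ⁻¹' (Function.uncurry φ ⁻¹' {y})) = K (r x) {y} := by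
        rw [← hfK, map_apply (hfm _) (measurableSet_singleton y)]
        refine measure_congr ?_
        filter_upwards [hae x] with u hu
        exact congrArg (· = y) hu
      rw [hset, hK, hκr, hber p hp hp1, mul_comm, ENNReal.ofReal_mul' (hκ0 _ _)]
    · intro x _
      refine mul_nonneg (Finset.prod_nonneg fun i _ ↦ ?_) (hκ0 _ _)
      rw [bitWeight]
      split_ifs <;> linarith
  · funext u
    simp [φ, s, r, hab]
lemma infinitePi_prod_infinitePi {ι X Y : Type*} [MeasurableSpace X] [MeasurableSpace Y]
    (μ : Measure X) (ν : Measure Y) [IsProbabilityMeasure μ] [IsProbabilityMeasure ν] :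
    ((infinitePi fun _ : ι ↦ μ).prod (infinitePi fun _ : ι ↦ ν)).map
      (fun q i ↦ (q.1 i, q.2 i)) = infinitePi fun _ : ι ↦ μ.prod ν := by
  refine eq_infinitePi _ fun s t ht ↦ ?_
  have hpi : MeasurableSet ((s : Set ι).pi t) := .pi s.countable_toSet fun i _ ↦ ht i
  have hzip : Measurable fun (q : (ι → X) × (ι → Y)) i ↦ (q.1 i, q.2 i) := by fun_prop
  have hg (i : ι) : Measurable fun y ↦ μ ((fun x ↦ (x, y)) ⁻¹' t i) :=
    measurable_measure_prodMk_right (ht i)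
  rw [map_apply hzip hpi, prod_apply_symm (hzip hpi)]
  have hin (y : ι → Y) : (infinitePi fun _ : ι ↦ μ)
      ((fun x ↦ (x, y)) ⁻¹' ((fun (q : (ι → X) × (ι → Y)) i ↦ (q.1 i, q.2 i)) ⁻¹'
        (s : Set ι).pi t)) = ∏ i ∈ s, μ ((fun x ↦ (x, y i)) ⁻¹' t i) :=
    infinitePi_pi (t := fun i ↦ (fun x ↦ (x, y i)) ⁻¹' t i) _
      fun i _ ↦ measurable_prodMk_right (ht i)
  simp_rw [hin]
  rw [lintegral_prod_eq_prod_lintegral_of_indepFun s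
    (fun i (y : ι → Y) ↦ μ ((fun x ↦ (x, y i)) ⁻¹' t i))
    (iIndepFun_infinitePi (P := fun _ ↦ ν) (X := fun i y ↦ μ ((fun x ↦ (x, y)) ⁻¹' t i)) hg)
    fun i ↦ (hg i).comp (measurable_pi_apply i)]
  refine Finset.prod_congr rfl fun i _ ↦ ?_
  rw [prod_apply_symm (ht i)]
  exact (measurePreserving_eval_infinitePi (fun _ : ι ↦ ν) i).lintegral_comp (hg i)

lemma ae_exists_apply_eq {κ B : Type*} [MeasurableSpace B] [MeasurableSingletonClass B]
    {m : Measure B} [IsProbabilityMeasure m] {a : B} (ha : m {a} ≠ 0) {e : ℕ → κ}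
    (he : Function.Injective e) :
    ∀ᵐ x ∂infinitePi fun _ : κ ↦ m, ∃ i, x (e i) = a := by
  have key (n : ℕ) : (infinitePi fun _ : κ ↦ m) {x | ¬ ∃ i, x (e i) = a} ≤ m {a}ᶜ ^ n := by
    calc _ ≤ (infinitePi fun _ : κ ↦ m)
          ((((Finset.range n).map ⟨e, he⟩ : Finset κ) : Set κ).pi fun _ ↦ {a}ᶜ) := by
          refine measure_mono fun x hx ↦ ?_
          intro k hk
          obtain ⟨i, -, rfl⟩ := Finset.mem_map.1 (Finset.mem_coe.1 hk)
          exact fun h ↦ hx ⟨i, h⟩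
      _ = _ := by
          rw [infinitePi_pi _ fun _ _ ↦ (measurableSet_singleton a).compl]
          simp
  refine ae_iff.2 (le_antisymm (ge_of_tendsto'
    (ENNReal.tendsto_pow_atTop_nhds_zero_of_lt_one ?_) key) zero_le)
  rw [prob_compl_eq_one_sub (measurableSet_singleton a)]
  exact ENNReal.sub_lt_self ENNReal.one_ne_top one_ne_zero ha

/-- Among the entries of `x` equal to `a` or `b` there is a first one, and it equals `a`. -/
def IsFirst {B : Type*} (a b : B) (x : ℕ → B) : Prop :=
  ∃ i, x i = a ∧ ∀ k < i, x k ≠ a ∧ x k ≠ b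

lemma not_isFirst_iff {B : Type*} {a b : B} (hab : a ≠ b) {x : ℕ → B} (hx : ∃ i, x i = a) :
    ¬ IsFirst a b x ↔ IsFirst b a x := by
  classical
  have hx' : ∃ i, x i = a ∨ x i = b := hx.imp fun _ ↦ Or.inl
  constructor
  · intro h
    refine ⟨Nat.find hx', ?_, fun k hk ↦ ?_⟩
    · refine (Nat.find_spec hx').resolve_left fun h' ↦ h ⟨_, h', fun k hk ↦ ?_⟩
      exact not_or.1 (Nat.find_min hx' hk)
    · exact (not_or.1 (Nat.find_min hx' hk)).symm
  · rintro ⟨i, hi, hi'⟩ ⟨j, hj, hj'⟩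
    rcases lt_trichotomy i j with h | rfl | h
    · exact (hj' i h).2 hi
    · exact hab (hj.symm.trans hi)
    · exact (hi' j h).2 hj

open Classical in
lemma isFirst_swap_iff {B : Type*} {a b : B} {x : ℕ → B} :
    IsFirst a b (fun i ↦ Equiv.swap a b (x i)) ↔ IsFirst b a x := by
  have h1 (y : B) : Equiv.swap a b y = a ↔ y = b := by
    rw [Equiv.swap_apply_eq_iff, Equiv.swap_apply_left]
  have h2 (y : B) : Equiv.swap a b y = b ↔ y = a := by
    rw [Equiv.swap_apply_eq_iff, Equiv.swap_apply_right]
  simp only [IsFirst, ne_eq, h1, h2]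

lemma measurableSet_isFirst {B : Type*} [MeasurableSpace B] [MeasurableSingletonClass B]
    (a b : B) : MeasurableSet {x : ℕ → B | IsFirst a b x} := by
  have h (i : ℕ) (c : B) : MeasurableSet {x : ℕ → B | x i = c} :=
    (measurable_pi_apply i : Measurable fun x : ℕ → B ↦ x i) (measurableSet_singleton c)
  have : {x : ℕ → B | IsFirst a b x} =
      ⋃ i, {x | x i = a} ∩ ⋂ k, ⋂ (_ : k < i), ({x | x k = a}ᶜ ∩ {x | x k = b}ᶜ) := by
    ext x
    simp [IsFirst]
  rw [this]
  exact .iUnion fun i ↦ (h i a).inter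
    (.iInter fun k ↦ .iInter fun _ ↦ (h k a).compl.inter (h k b).compl)

open Classical in
/-- For each row of the array `x`, whether `a` occurs in it before `b`. -/
noncomputable def orientation {J B : Type*} (a b : B) (x : J × ℕ → B) (j : J) : Bool :=
  decide (IsFirst a b fun i ↦ x (j, i))

lemma measurable_orientation {J B : Type*} [MeasurableSpace B] [MeasurableSingletonClass B]
    (a b : B) : Measurable (orientation (J := J) a b) := by
  refine measurable_pi_iff.2 fun j ↦ measurable_to_bool ?_
  have h : Measurable fun (x : J × ℕ → B) (i : ℕ) ↦ x (j, i) := by fun_prop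
  convert h (measurableSet_isFirst a b) using 1
  ext x
  simp [orientation]

open Classical in
/-- Exchange `a` and `b` throughout row `j`. -/
noncomputable def swapRow {J B : Type*} (a b : B) (j : J) (x : J × ℕ → B) (k : J × ℕ) : B :=
  if k.1 = j then Equiv.swap a b (x k) else x k

lemma orientation_eq_true_iff {J B : Type*} {a b : B} {x : J × ℕ → B} {j : J} :
    orientation a b x j = true ↔ IsFirst a b fun i ↦ x (j, i) := by
  simp [orientation]

lemma orientation_swapRow_of_ne {J B : Type*} {a b : B} {i j : J} (hij : i ≠ j)
    (x : J × ℕ → B) : orientation a b (swapRow a b j x) i = orientation a b x i := by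
  have h : (fun k ↦ swapRow a b j x (i, k)) = fun k ↦ x (i, k) := by
    funext k
    simp [swapRow, hij]
  rw [Bool.eq_iff_iff, orientation_eq_true_iff, orientation_eq_true_iff, h]

open Classical in
lemma orientation_swapRow_self {J B : Type*} {a b : B} (hab : a ≠ b) {j : J}
    {x : J × ℕ → B} (hx : ∃ i, x (j, i) = a) :
    orientation a b (swapRow a b j x) j = !orientation a b x j := by
  have h : (fun k ↦ swapRow a b j x (j, k)) = fun k ↦ Equiv.swap a b (x (j, k)) := by
    funext k
    simp [swapRow]
  rw [Bool.eq_iff_iff, orientation_eq_true_iff, h, isFirst_swap_iff, ← not_isFirst_iff hab hx,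
    ← orientation_eq_true_iff]
  simp

lemma measurePreserving_swapRow {J B : Type*} [MeasurableSpace B] [MeasurableSingletonClass B]
    [Countable B] {m : Measure B} [IsProbabilityMeasure m] {a b : B} (hm : m {a} = m {b})
    (j : J) : MeasurePreserving (swapRow a b j) (infinitePi fun _ : J × ℕ ↦ m)
      (infinitePi fun _ : J × ℕ ↦ m) := by
  classical
  have hmap : m.map (Equiv.swap a b) = m := by
    refine ext_of_singleton fun c ↦ ?_
    have : Equiv.swap a b ⁻¹' {c} = {Equiv.swap a b c} := by
      ext y; simp [Equiv.swap_apply_eq_iff]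
    rw [map_apply (measurable_of_countable _) (measurableSet_singleton c), this]
    by_cases hca : c = a
    · subst hca; rw [Equiv.swap_apply_left, hm]
    by_cases hcb : c = b
    · subst hcb; rw [Equiv.swap_apply_right, hm]
    rw [Equiv.swap_apply_of_ne_of_ne hca hcb]
  let g (k : J × ℕ) (y : B) : B := if k.1 = j then Equiv.swap a b y else y
  have hg (k) : Measurable (g k) := measurable_of_countable _
  have hgm (k) : m.map (g k) = m := by
    by_cases hk : k.1 = j
    · simpa [g, hk] using hmap
    · simp [g, hk]
  have heq : swapRow a b j = fun x k ↦ g k (x k) := by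
    ext x k; simp [swapRow, g]
  rw [heq]
  refine ⟨by fun_prop, ?_⟩
  rw [infinitePi_map_pi (fun _ ↦ m) hg]
  simp_rw [hgm]

lemma map_prodMk_eq_prod_of_flip {J Ω E : Type*} [MeasurableSpace Ω] [MeasurableSpace E]
    {Q : Measure Ω} [IsProbabilityMeasure Q] {γ : Ω → J → Bool} {Y : Ω → E} (hγ : Measurable γ)
    (hY : Measurable Y) {T : J → Ω → Ω} (hT : ∀ j, MeasurePreserving (T j) Q Q)
    (hYT : ∀ j ω, Y (T j ω) = Y ω) (hne : ∀ i j, i ≠ j → ∀ ω, γ (T j ω) i = γ ω i)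
    (hself : ∀ j, ∀ᵐ ω ∂Q, γ (T j ω) j = !γ ω j) :
    Q.map (fun ω ↦ (γ ω, Y ω)) = (fairBits J).prod (Q.map Y) := by
  classical
  have hfin (S : Set E) (hS : MeasurableSet S) (c : J → Bool) (s : Finset J) :
      Q ({ω | ∀ i ∈ s, γ ω i = c i} ∩ Y ⁻¹' S) = 2⁻¹ ^ s.card * Q (Y ⁻¹' S) := by
    induction s using Finset.induction_on with
    | empty => simp
    | insert j s hj ih =>
      set A := {ω | ∀ i ∈ s, γ ω i = c i} ∩ Y ⁻¹' S with hA
      have hm (i : J) : MeasurableSet {ω | γ ω i = c i} :=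
        ((measurable_pi_apply i).comp hγ) (measurableSet_singleton (c i))
      have h1 : {ω | ∀ i ∈ insert j s, γ ω i = c i} ∩ Y ⁻¹' S = A ∩ {ω | γ ω j = c j} := by
        ext ω
        simp [hA]
        tauto
      have hAm : MeasurableSet A := by
        refine .inter ?_ (hY hS)
        have : {ω | ∀ i ∈ s, γ ω i = c i} = ⋂ i ∈ s, {ω | γ ω i = c i} := by ext; simp
        rw [this]
        exact .biInter s.countable_toSet fun i _ ↦ hm i
      have h2 : T j ⁻¹' (A ∩ {ω | γ ω j = c j}) =ᵐ[Q] (A \ {ω | γ ω j = c j} : Set Ω) := by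
        filter_upwards [hself j] with ω hω
        have hAT : T j ω ∈ A ↔ ω ∈ A := by
          simp only [hA, Set.mem_inter_iff, Set.mem_preimage, hYT, Set.mem_ofPred_eq]
          refine and_congr_left fun _ ↦ forall₂_congr fun i hi ↦ ?_
          rw [hne i j (fun h ↦ hj (h ▸ hi))]
        have hc : γ (T j ω) j = c j ↔ ¬ γ ω j = c j := by
          rw [hω]
          cases γ ω j <;> cases c j <;> simp
        exact propext (and_congr hAT hc)
      have h3 : Q (A ∩ {ω | γ ω j = c j}) = Q (A \ {ω | γ ω j = c j}) := by
        rw [← measure_congr h2, (hT j).measure_preimage (hAm.inter (hm j)).nullMeasurableSet]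
      have h4 := measure_inter_add_sdiff (μ := Q) A (hm j)
      rw [← h3, ih, ← two_mul] at h4
      rw [h1, Finset.card_insert_of_notMem hj, pow_succ, mul_right_comm, ← h4, mul_comm,
        ← mul_assoc, ENNReal.inv_mul_cancel two_ne_zero ENNReal.ofNat_ne_top, one_mul]
  have : IsProbabilityMeasure (Q.map Y) := isProbabilityMeasure_map hY.aemeasurable
  refine (Measure.prod_eq fun C S hC hS ↦ ?_).symm
  rw [map_apply (hγ.prodMk hY) (hC.prod hS), map_apply hY hS]
  have hpre : (fun ω ↦ (γ ω, Y ω)) ⁻¹' C ×ˢ S = Y ⁻¹' S ∩ γ ⁻¹' C := by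
    ext; simp [and_comm]
  rw [hpre]
  by_cases h0 : Q (Y ⁻¹' S) = 0
  · rw [h0, mul_zero]
    exact measure_mono_null Set.inter_subset_left h0
  have := cond_isProbabilityMeasure h0
  have hcond : (Q[|Y ⁻¹' S]).map γ = fairBits J := by
    refine isBernoulliProduct_iff.1 ⟨isProbabilityMeasure_map hγ.aemeasurable, fun s c ↦ ?_⟩
    have hms : MeasurableSet {x : J → Bool | ∀ i ∈ s, x i = c i} := by
      have : {x : J → Bool | ∀ i ∈ s, x i = c i} = (s : Set J).pi fun i ↦ {c i} := by
        ext x; simp [Set.mem_pi]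
      rw [this]
      exact .pi s.countable_toSet fun _ _ ↦ measurableSet_singleton _
    have h2 : ENNReal.ofReal (1 / 2) = 2⁻¹ := by
      rw [one_div, ENNReal.ofReal_inv_of_pos (by norm_num)]; simp
    rw [map_apply hγ hms, cond_apply (hY hS), Set.inter_comm]
    have := hfin S hS c s
    rw [Set.preimage_ofPred_eq, this, mul_comm, mul_assoc,
      ENNReal.mul_inv_cancel h0 (measure_ne_top _ _), mul_one]
    norm_num [h2]
  rw [← hcond, map_apply hγ hC, cond_mul_eq_inter (hY hS)]

lemma map_orientation_eq_prod {J B B' U : Type*} [MeasurableSpace B] [MeasurableSpace B']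
    [MeasurableSpace U] [MeasurableSingletonClass B] [Countable B] {m : Measure B}
    [IsProbabilityMeasure m] {ν : Measure U} [IsProbabilityMeasure ν] {m' : Measure B'} {a b : B}
    (hab : a ≠ b) (hm : m {a} = m {b}) (ha : m {a} ≠ 0) {φ : B → U → B'}
    (hφ : Measurable (Function.uncurry φ)) (hφm : (m.prod ν).map (Function.uncurry φ) = m')
    (hφab : φ a = φ b) :
    ((infinitePi fun _ : J × ℕ ↦ m).prod (infinitePi fun _ : J × ℕ ↦ ν)).map
      (fun q ↦ (orientation a b q.1, fun k ↦ φ (q.1 k) (q.2 k))) =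
      (fairBits J).prod (infinitePi fun _ : J × ℕ ↦ m') := by
  subst hφm
  have hY : Measurable fun (q : (J × ℕ → B) × (J × ℕ → U)) k ↦ φ (q.1 k) (q.2 k) :=
    measurable_pi_iff.2 fun k ↦ hφ.comp (by fun_prop : Measurable
      fun q : (J × ℕ → B) × (J × ℕ → U) ↦ (q.1 k, q.2 k))
  have hlaw : ((infinitePi fun _ : J × ℕ ↦ m).prod (infinitePi fun _ : J × ℕ ↦ ν)).map
      (fun q k ↦ φ (q.1 k) (q.2 k)) =
      infinitePi fun _ : J × ℕ ↦ (m.prod ν).map (Function.uncurry φ) := by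
    rw [← infinitePi_map_pi _ fun _ ↦ hφ, ← infinitePi_prod_infinitePi, map_map (by fun_prop)
      (by fun_prop)]
    rfl
  rw [← hlaw]
  refine map_prodMk_eq_prod_of_flip ((measurable_orientation a b).comp measurable_fst) hY
    (T := fun j q ↦ (swapRow a b j q.1, q.2))
    (fun j ↦ (measurePreserving_swapRow hm j).prod (.id _)) (fun j q ↦ ?_)
    (fun i j hij q ↦ orientation_swapRow_of_ne hij _) (fun j ↦ ?_)
  · classical
    ext k
    simp only [swapRow]
    split_ifs with hk
    · by_cases h1 : q.1 k = a
      · rw [h1, Equiv.swap_apply_left, hφab]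
      by_cases h2 : q.1 k = b
      · rw [h2, Equiv.swap_apply_right, hφab]
      rw [Equiv.swap_apply_of_ne_of_ne h1 h2]
    · rfl
  · have h := ae_exists_apply_eq (κ := J × ℕ) ha (e := fun i ↦ (j, i))
      (fun _ _ h ↦ (Prod.ext_iff.1 h).2)
    filter_upwards [quasiMeasurePreserving_fst.ae h] with q hq
    exact orientation_swapRow_self hab hq

/-- Split a sequence of bits into a sequence of bits for every index in `ℕ × ℕ`. -/
def splitBits (v : ℕ → Bool) (k : ℕ × ℕ) (i : ℕ) : Bool :=
  v (Nat.pair (Nat.pair k.1 k.2) i)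

lemma measurePreserving_splitBits :
    MeasurePreserving splitBits (fairBits ℕ) (infinitePi fun _ : ℕ × ℕ ↦ fairBits ℕ) := by
  have h1 : MeasurePreserving (fun (v : ℕ → Bool) (k : (ℕ × ℕ) × ℕ) ↦
      v (Nat.pair (Nat.pair k.1.1 k.1.2) k.2)) (fairBits ℕ) (fairBits ((ℕ × ℕ) × ℕ)) := by
    have hinj : Function.Injective fun k : (ℕ × ℕ) × ℕ ↦ Nat.pair (Nat.pair k.1.1 k.1.2) k.2 := by
      rintro ⟨⟨i, j⟩, k⟩ ⟨⟨i', j'⟩, k'⟩ h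
      simp only [Nat.pair_eq_pair] at h
      simp [h]
    exact ⟨measurable_pi_iff.2 fun k ↦ measurable_pi_apply _,
      map_infinitePi_infinitePi_of_inj (P := fun _ : ℕ ↦ bernoulliMeasure (1 / 2)) hinj⟩
  have h2 := infinitePi_map_curry (ι := ℕ × ℕ) (κ := ℕ) fun _ _ ↦ bernoulliMeasure (1 / 2)
  refine MeasurePreserving.comp (g := MeasurableEquiv.curry (ℕ × ℕ) ℕ Bool) ⟨by fun_prop, h2⟩ h1

lemma map_orientation_splitBits {B B' : Type*} [MeasurableSpace B] [MeasurableSpace B']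
    [MeasurableSingletonClass B] [Countable B] {m : Measure B}
    [IsProbabilityMeasure m] {m' : Measure B'} {a b : B}
    (hab : a ≠ b) (hm : m {a} = m {b}) (ha : m {a} ≠ 0) {φ : B → (ℕ → Bool) → B'}
    (hφ : Measurable (Function.uncurry φ))
    (hφm : (m.prod (fairBits ℕ)).map (Function.uncurry φ) = m') (hφab : φ a = φ b) :
    ((infinitePi fun _ : ℕ × ℕ ↦ m).prod (fairBits ℕ)).map
      (fun q ↦ (orientation a b q.1, fun k ↦ φ (q.1 k) (splitBits q.2 k))) =
      (fairBits ℕ).prod (infinitePi fun _ : ℕ × ℕ ↦ m') := by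
  have hY : Measurable fun (q : (ℕ × ℕ → B) × (ℕ × ℕ → ℕ → Bool)) k ↦ φ (q.1 k) (q.2 k) :=
    measurable_pi_iff.2 fun k ↦ hφ.comp (by fun_prop : Measurable
      fun q : (ℕ × ℕ → B) × (ℕ × ℕ → ℕ → Bool) ↦ (q.1 k, q.2 k))
  have h := (MeasurePreserving.id (infinitePi fun _ : ℕ × ℕ ↦ m)).prod measurePreserving_splitBits
  have hγY := ((measurable_orientation a b).comp measurable_fst).prodMk hY
  rw [← map_orientation_eq_prod hab hm ha hφ hφm hφab, ← h.map_eq]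
  exact (map_map hγY h.measurable).symm

lemma eq_infinitePi_of_forall_lt {Ω : Type*} [MeasurableSpace Ω] {P : Measure Ω}
    [IsProbabilityMeasure P] {Q : Measure (ℕ → Ω)}
    (h : ∀ N (t : ℕ → Set Ω), (∀ n, MeasurableSet (t n)) →
      Q {x | ∀ n < N, x n ∈ t n} = ∏ n ∈ Finset.range N, P (t n)) :
    Q = infinitePi fun _ : ℕ ↦ P := by
  classical
  refine eq_infinitePi _ fun s t ht ↦ ?_
  obtain ⟨N, hN⟩ : ∃ N, s ⊆ Finset.range N :=
    ⟨s.sup id + 1, fun i hi ↦ Finset.mem_range_succ_iff.2 (Finset.le_sup (f := id) hi)⟩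
  let t' (i : ℕ) : Set Ω := if i ∈ s then t i else Set.univ
  have ht' (i : ℕ) : MeasurableSet (t' i) := by
    dsimp only [t']; split_ifs; exacts [ht i, .univ]
  have hpi : (s : Set ℕ).pi t = {x | ∀ n < N, x n ∈ t' n} := by
    ext x
    simp only [Set.mem_pi, Finset.mem_coe, Set.mem_ofPred_eq]
    refine ⟨fun hx n _ ↦ ?_, fun hx n hn ↦ ?_⟩
    · by_cases hn : n ∈ s
      · simpa [t', hn] using hx n hn
      · simp [t', hn]
    · simpa [t', hn] using hx n (Finset.mem_range.1 (hN hn))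
  rw [hpi, h N t' ht']
  refine (Finset.prod_subset_one_on_sdiff hN (fun i hi ↦ ?_) fun i hi ↦ ?_).symm
  · simp [t', (Finset.mem_sdiff.1 hi).2]
  · simp [t', hi]

lemma map_cons_infinitePi {Ω : Type*} [MeasurableSpace Ω] (P : Measure Ω)
    [IsProbabilityMeasure P] :
    (P.prod (infinitePi fun _ : ℕ ↦ P)).map
      (fun q n ↦ Nat.casesOn (motive := fun _ ↦ Ω) n q.1 q.2) = infinitePi fun _ : ℕ ↦ P := by
  have hmeas : Measurable (fun (q : Ω × (ℕ → Ω)) n ↦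
      Nat.casesOn (motive := fun _ ↦ Ω) n q.1 q.2) := by
    refine measurable_pi_iff.2 fun n ↦ ?_
    cases n <;> fun_prop
  refine eq_infinitePi_of_forall_lt fun N t ht ↦ ?_
  have hset (N : ℕ) (t : ℕ → Set Ω) :
      {x : ℕ → Ω | ∀ n < N, x n ∈ t n} = (Finset.range N : Set ℕ).pi t := by
    ext; simp
  rw [hset, map_apply hmeas (.pi (Finset.countable_toSet _) fun i _ ↦ ht i)]
  cases N with
  | zero => simp
  | succ N =>
    have hpre : (fun (q : Ω × (ℕ → Ω)) n ↦ Nat.casesOn (motive := fun _ ↦ Ω) n q.1 q.2) ⁻¹'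
        (Finset.range (N + 1) : Set ℕ).pi t =
        t 0 ×ˢ ((Finset.range N : Set ℕ).pi fun i ↦ t (i + 1)) := by
      ext q
      simp only [Set.mem_preimage, Set.mem_pi, Finset.mem_coe, Set.mem_prod, Finset.mem_range]
      refine ⟨fun h ↦ ⟨h 0 (by lia), fun i hi ↦ h (i + 1) (by lia)⟩, ?_⟩
      rintro ⟨h0, h⟩ (_ | i) hi
      · exact h0
      · exact h i (by lia)
    rw [hpre, prod_prod, infinitePi_pi _ fun i _ ↦ ht _, mul_comm,
      ← Finset.prod_range_succ' fun n ↦ P (t n)]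

lemma map_chain_eq_prod {Ω Ω' V : Type*} [MeasurableSpace Ω] [MeasurableSpace Ω']
    [MeasurableSpace V] {P : Measure Ω} [IsProbabilityMeasure P] {P' : Measure Ω'}
    [IsProbabilityMeasure P'] {ν : Measure V} [IsProbabilityMeasure ν] {γ : Ω → V}
    {Φ : Ω × V → Ω'} (hγ : Measurable γ) (hΦ : Measurable Φ)
    (h : (P.prod ν).map (fun q ↦ (γ q.1, Φ q)) = ν.prod P') :
    (infinitePi fun _ : ℕ ↦ P).map (fun x ↦ (γ (x 0), fun n ↦ Φ (x n, γ (x (n + 1))))) =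
      ν.prod (infinitePi fun _ : ℕ ↦ P') := by
  classical
  have hF (n : ℕ) : Measurable fun x : ℕ → Ω ↦ Φ (x n, γ (x (n + 1))) := by fun_prop
  have hD (N : ℕ) (t : ℕ → Set Ω') (ht : ∀ n, MeasurableSet (t n)) :
      MeasurableSet {x : ℕ → Ω | ∀ n < N, Φ (x n, γ (x (n + 1))) ∈ t n} := by
    have : {x : ℕ → Ω | ∀ n < N, Φ (x n, γ (x (n + 1))) ∈ t n} =
        ⋂ n, ⋂ (_ : n < N), (fun x : ℕ → Ω ↦ Φ (x n, γ (x (n + 1)))) ⁻¹' t n := by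
      ext; simp
    rw [this]
    exact .iInter fun n ↦ .iInter fun _ ↦ hF n (ht n)
  have hg0 : Measurable fun x : ℕ → Ω ↦ γ (x 0) := by fun_prop
  have hC0 (C : Set V) (hC : MeasurableSet C) : MeasurableSet {x : ℕ → Ω | γ (x 0) ∈ C} := hg0 hC
  have hγν : P.map γ = ν := by
    have h1 := congrArg (Measure.map Prod.fst) h
    have h2 : Prod.fst ∘ (fun q : Ω × V ↦ (γ q.1, Φ q)) = γ ∘ Prod.fst := rfl
    rw [map_map measurable_fst (by fun_prop), h2, ← map_map hγ measurable_fst,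
      Measure.map_fst_prod, Measure.map_fst_prod] at h1
    simpa using h1
  have hγ0 (C : Set V) (hC : MeasurableSet C) :
      (infinitePi fun _ : ℕ ↦ P) {x | γ (x 0) ∈ C} = ν C := by
    rw [← hγν, map_apply hγ hC]
    exact (measurePreserving_eval_infinitePi (fun _ : ℕ ↦ P) 0).measure_preimage
      (hγ hC).nullMeasurableSet
  have key (N : ℕ) : ∀ (C : Set V) (t : ℕ → Set Ω'), MeasurableSet C →
      (∀ n, MeasurableSet (t n)) → (infinitePi fun _ : ℕ ↦ P)
        ({x | ∀ n < N, Φ (x n, γ (x (n + 1))) ∈ t n} ∩ {x | γ (x 0) ∈ C}) =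
        (∏ n ∈ Finset.range N, P' (t n)) * ν C := by
    induction N with
    | zero =>
      intro C t hC _
      simpa using hγ0 C hC
    | succ N ih =>
      intro C t hC ht
      set D := {x : ℕ → Ω | ∀ n < N, Φ (x n, γ (x (n + 1))) ∈ t (n + 1)} with hDdef
      have hDm : MeasurableSet D := hD N (fun n ↦ t (n + 1)) fun n ↦ ht _
      set R := (infinitePi fun _ : ℕ ↦ P).restrict D with hR
      have hRmap : R.map (fun x ↦ γ (x 0)) =
          (∏ n ∈ Finset.range N, P' (t (n + 1))) • ν := by
        ext C' hC'
        rw [map_apply hg0 hC', hR, restrict_apply (hg0 hC'), Set.inter_comm]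
        exact ih C' (fun n ↦ t (n + 1)) hC' fun n ↦ ht _
      have hmeas : Measurable (fun (q : Ω × (ℕ → Ω)) n ↦
          Nat.casesOn (motive := fun _ ↦ Ω) n q.1 q.2) := by
        refine measurable_pi_iff.2 fun n ↦ ?_
        cases n <;> fun_prop
      have hq : Measurable fun q : Ω × V ↦ (γ q.1, Φ q) := by fun_prop
      rw [← map_cons_infinitePi, map_apply hmeas ((hD _ t ht).inter (hC0 C hC))]
      have hpre : (fun (q : Ω × (ℕ → Ω)) n ↦
          Nat.casesOn (motive := fun _ ↦ Ω) n q.1 q.2) ⁻¹'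
          ({x | ∀ n < N + 1, Φ (x n, γ (x (n + 1))) ∈ t n} ∩ {x | γ (x 0) ∈ C}) =
          (Prod.map id fun x : ℕ → Ω ↦ γ (x 0)) ⁻¹'
            ((fun q : Ω × V ↦ (γ q.1, Φ q)) ⁻¹' C ×ˢ t 0) ∩ Set.univ ×ˢ D := by
        ext q
        simp only [Set.mem_preimage, Set.mem_inter_iff, Set.mem_ofPred_eq, Set.mem_prod,
          Set.mem_univ, true_and, hDdef, Prod.map_fst, id]
        constructor
        · rintro ⟨h1, h2⟩
          exact ⟨⟨h2, h1 0 (by lia)⟩, fun n hn ↦ h1 (n + 1) (by lia)⟩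
        · rintro ⟨⟨h1, h2⟩, h3⟩
          refine ⟨?_, h1⟩
          rintro (_ | n) hn
          · exact h2
          · exact h3 n (by lia)
      rw [hpre, ← restrict_apply ((measurable_id.prodMap hg0) (hq (hC.prod (ht 0)))),
        ← Measure.prod_restrict, restrict_univ, ← hR, ← map_apply (measurable_id.prodMap hg0)
        (hq (hC.prod (ht 0))), ← map_prod_map _ _ measurable_id hg0, hRmap, Measure.map_id,
        prod_smul_right, Measure.smul_apply, ← map_apply hq (hC.prod (ht 0)), h, prod_prod,
        Finset.prod_range_succ', smul_eq_mul]
      ring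
  have hFm : Measurable fun (x : ℕ → Ω) n ↦ Φ (x n, γ (x (n + 1))) := measurable_pi_iff.2 hF
  refine (Measure.prod_eq fun C S hC hS ↦ ?_).symm
  rw [map_apply (hg0.prodMk hFm) (hC.prod hS)]
  change (infinitePi fun _ : ℕ ↦ P) ({x | γ (x 0) ∈ C} ∩
    (fun (x : ℕ → Ω) n ↦ Φ (x n, γ (x (n + 1)))) ⁻¹' S) = _
  by_cases h0 : ν C = 0
  · rw [h0, zero_mul]
    exact measure_mono_null Set.inter_subset_left ((hγ0 C hC).trans h0)
  have h0' : (infinitePi fun _ : ℕ ↦ P) {x | γ (x 0) ∈ C} ≠ 0 := by rwa [hγ0 C hC]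
  have hcond : ((infinitePi fun _ : ℕ ↦ P)[|{x | γ (x 0) ∈ C}]).map
      (fun x n ↦ Φ (x n, γ (x (n + 1)))) = infinitePi fun _ : ℕ ↦ P' := by
    refine eq_infinitePi_of_forall_lt fun N t ht ↦ ?_
    have hset : {x : ℕ → Ω' | ∀ n < N, x n ∈ t n} = (Finset.range N : Set ℕ).pi t := by
      ext; simp
    have hmeas : MeasurableSet {x : ℕ → Ω' | ∀ n < N, x n ∈ t n} := by
      rw [hset]
      exact .pi (Finset.countable_toSet _) fun i _ ↦ ht i
    rw [map_apply hFm hmeas, cond_apply (hC0 C hC), hγ0 C hC, Set.inter_comm,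
      Set.preimage_ofPred_eq, key N C t hC ht, mul_comm, mul_assoc,
      ENNReal.mul_inv_cancel h0 (measure_ne_top _ _), mul_one]
  rw [← hcond, map_apply hFm hS, ← hγ0 C hC, mul_comm, cond_mul_eq_inter (hC0 C hC)]

/-- Regard a configuration as a sequence of arrays of rows indexed by `L`. -/
noncomputable def toArrays {I L : Type*} (e : ℕ × (ℕ × ℕ) × L ≃ I) :
    (I → Bool) ≃ᵐ (ℕ → ℕ × ℕ → L → Bool) :=
  ((MeasurableEquiv.piCongrLeft (fun _ : I ↦ Bool) e).symm.trans
    (MeasurableEquiv.curry ℕ ((ℕ × ℕ) × L) Bool)).trans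
    (MeasurableEquiv.piCongrRight fun _ ↦ MeasurableEquiv.curry (ℕ × ℕ) L Bool)

lemma toArrays_apply {I L : Type*} (e : ℕ × (ℕ × ℕ) × L ≃ I) (x : I → Bool) (i : ℕ)
    (k : ℕ × ℕ) (l : L) : toArrays e x i k l = x (e (i, k, l)) :=
  rfl

lemma map_toArrays {I L : Type*} (e : ℕ × (ℕ × ℕ) × L ≃ I) (m : Measure Bool)
    [IsProbabilityMeasure m] :
    (infinitePi fun _ : I ↦ m).map (toArrays e) =
      infinitePi fun _ : ℕ ↦ infinitePi fun _ : ℕ × ℕ ↦ infinitePi fun _ : L ↦ m := by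
  have h1 : MeasurePreserving (MeasurableEquiv.piCongrLeft (fun _ : I ↦ Bool) e).symm
      (infinitePi fun _ : I ↦ m) (infinitePi fun _ : ℕ × (ℕ × ℕ) × L ↦ m) :=
    MeasurePreserving.symm (MeasurableEquiv.piCongrLeft (fun _ : I ↦ Bool) e)
      ⟨MeasurableEquiv.measurable _, infinitePi_map_piCongrLeft (fun _ : I ↦ m) e⟩
  have h2 : MeasurePreserving (MeasurableEquiv.curry ℕ ((ℕ × ℕ) × L) Bool)
      (infinitePi fun _ ↦ m) (infinitePi fun _ ↦ infinitePi fun _ ↦ m) :=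
    ⟨MeasurableEquiv.measurable _, infinitePi_map_curry fun _ _ ↦ m⟩
  have h3 : (infinitePi fun _ : (ℕ × ℕ) × L ↦ m).map (MeasurableEquiv.curry (ℕ × ℕ) L Bool) =
      infinitePi fun _ ↦ infinitePi fun _ ↦ m :=
    infinitePi_map_curry fun _ _ ↦ m
  have h4 := infinitePi_map_pi (fun _ : ℕ ↦ infinitePi fun _ : (ℕ × ℕ) × L ↦ m)
    fun _ ↦ (MeasurableEquiv.curry (ℕ × ℕ) L Bool).measurable
  rw [h3] at h4
  exact (MeasurePreserving.comp (g := MeasurableEquiv.piCongrRight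
    fun _ : ℕ ↦ MeasurableEquiv.curry (ℕ × ℕ) L Bool) ⟨MeasurableEquiv.measurable _, h4⟩
    (h2.comp h1)).map_eq

/-- For every `0 < p < p' < 1` there is a discrete thickening `F` from density `p` to
density `p'` on `{0,1}^ℤ` together with a measurable `G` extracting infinitely many
i.i.d. fair bits from `X` which are independent of the thickened process `F(X)`. -/
theorem thickening_with_extra_bits (p p' : ℝ) (hp : 0 < p) (hpp' : p < p') (hp' : p' < 1)
    (μ : Measure (ℤ → Bool)) (hμ : IsBernoulliProduct p μ) :
    ∃ (F : (ℤ → Bool) → (ℤ → Bool)) (G : (ℤ → Bool) → (ℕ → Bool)),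
      Measurable F ∧ Measurable G ∧
      IsBernoulliProduct p' (μ.map F) ∧
      (∀ᵐ x ∂μ, ∀ i : ℤ, x i ≤ F x i) ∧
      IsBernoulliProduct (1/2) (μ.map G) ∧
      IndepFun G F μ := by
  have := isProbabilityMeasure_bernoulliMeasure hp.le (hpp'.trans hp').le
  have := isProbabilityMeasure_bernoulliMeasure (hp.trans hpp').le hp'.le
  rw [isBernoulliProduct_iff] at hμ
  obtain ⟨n, a, b, φ, hab, hm, ha, hφ, hφm, hle, hφab⟩ := exists_blockThickening hp hpp' hp'
  have : Nonempty (Fin n) := by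
    by_contra h
    rw [not_nonempty_iff] at h
    exact hab (Subsingleton.elim a b)
  obtain ⟨e⟩ := nonempty_equiv_of_countable (α := ℕ × (ℕ × ℕ) × Fin n) (β := ℤ)
  let γ : (ℕ × ℕ → Fin n → Bool) → ℕ → Bool := orientation a b
  let Φ (q : (ℕ × ℕ → Fin n → Bool) × (ℕ → Bool)) (k : ℕ × ℕ) : Fin n → Bool :=
    φ (q.1 k) (splitBits q.2 k)
  have hγ : Measurable γ := measurable_orientation a b
  have hΦ : Measurable Φ := by
    refine measurable_pi_iff.2 fun k ↦ hφ.comp (Measurable.prodMk (by fun_prop) ?_)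
    exact (measurable_pi_apply k).comp (measurePreserving_splitBits.measurable.comp measurable_snd)
  let F₀ (X : ℕ → ℕ × ℕ → Fin n → Bool) (i : ℕ) : ℕ × ℕ → Fin n → Bool := Φ (X i, γ (X (i + 1)))
  have hF₀ : Measurable F₀ := by fun_prop
  have hchain := map_chain_eq_prod hγ hΦ (map_orientation_splitBits hab hm ha hφ hφm hφab)
  let G (x : ℤ → Bool) : ℕ → Bool := γ (toArrays e x 0)
  let F (x : ℤ → Bool) : ℤ → Bool := (toArrays e).symm (F₀ (toArrays e x))
  have hG : Measurable G := by fun_prop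
  have hF : Measurable F := by fun_prop
  have hsymm : (infinitePi fun _ : ℕ ↦ infinitePi fun _ : ℕ × ℕ ↦ infinitePi fun _ : Fin n ↦
      bernoulliMeasure p').map (toArrays e).symm = infinitePi fun _ : ℤ ↦ bernoulliMeasure p' := by
    rw [← map_toArrays e, MeasurableEquiv.map_symm_map]
  have hjoint : μ.map (fun x ↦ (G x, F x)) =
      (fairBits ℕ).prod (infinitePi fun _ : ℤ ↦ bernoulliMeasure p') := by
    rw [← hsymm, ← Measure.map_id (μ := fairBits ℕ), map_prod_map _ _ measurable_id
      (MeasurableEquiv.measurable _), ← hchain, ← map_toArrays e, ← hμ, map_map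
      (by fun_prop) (by fun_prop), map_map (by fun_prop) (by fun_prop)]
    rfl
  have hGlaw : μ.map G = fairBits ℕ := by
    have := congrArg (Measure.map Prod.fst) hjoint
    rw [map_map measurable_fst (hG.prodMk hF), Measure.map_fst_prod, measure_univ,
      one_smul] at this
    exact this
  have hFlaw : μ.map F = infinitePi fun _ : ℤ ↦ bernoulliMeasure p' := by
    have := congrArg (Measure.map Prod.snd) hjoint
    rw [map_map measurable_snd (hG.prodMk hF), Measure.map_snd_prod, measure_univ,
      one_smul] at this
    exact this
  have : IsProbabilityMeasure μ := by rw [hμ]; infer_instance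
  refine ⟨F, G, hF, hG, isBernoulliProduct_iff.2 hFlaw, ae_of_all _ fun x i ↦ ?_,
    isBernoulliProduct_iff.2 hGlaw, ?_⟩
  · obtain ⟨⟨j, k, l⟩, rfl⟩ := e.surjective i
    rw [← toArrays_apply e x, ← toArrays_apply e (F x)]
    simp only [F, MeasurableEquiv.apply_symm_apply]
    exact hle _ _ l
  · rw [indepFun_iff_map_prod_eq_prod_map_map hG.aemeasurable hF.aemeasurable, hjoint, hGlaw,
      hFlaw]
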